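/- For all 0 ≤ α ≤ β and every t > 0 one has (1/√(4πt)) · ∫_α^β ∫₀^α e^{−(x−y)²/(4t)} dy dx = √t·( H(β/(2√t)) − H(α/(2√t)) − H((β−α)/(2√t)) + 1/√π ). -/

import Mathlib

open MeasureTheory

/-- The complementary error function `erfc(x) = (2/√π) ∫_x^∞ e^{−s²} ds`. -/
noncomputable def erfc (x : ℝ) : ℝ :=
  (2 / Real.sqrt Real.pi) * ∫ s in Set.Ioi x, Real.exp (-s ^ 2)

/-- The function `H(x) = (1/√π)·e^{−x²} − x·erfc(x)`. -/
noncomputable def H (x : ℝ) : ℝ :=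
  (1 / Real.sqrt Real.pi) * Real.exp (-x ^ 2) - x * erfc x

theorem hasDerivAt_erfc (x : ℝ) :
    HasDerivAt erfc (-(2 / Real.sqrt Real.pi * Real.exp (-x ^ 2))) x := by
  have hgauss : Integrable fun s : ℝ => Real.exp (-s ^ 2) := by
    simpa using integrable_exp_neg_mul_sq (b := 1) one_pos
  have hcont : Continuous fun s : ℝ => Real.exp (-s ^ 2) := by fun_prop
  have heq : erfc = fun u => 2 / Real.sqrt Real.pi *
      ((∫ s in Set.Ioi (0 : ℝ), Real.exp (-s ^ 2)) - ∫ s in (0 : ℝ)..u, Real.exp (-s ^ 2)) := by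
    funext u
    rw [erfc, ← intervalIntegral.integral_interval_add_Ioi (a := (0 : ℝ)) (b := u)
      hgauss.integrableOn hgauss.integrableOn, add_sub_cancel_left]
  rw [heq]
  refine (((hcont.integral_hasStrictDerivAt 0 x).hasDerivAt.const_sub
    (∫ s in Set.Ioi (0 : ℝ), Real.exp (-s ^ 2))).const_mul (2 / Real.sqrt Real.pi)).congr_deriv ?_
  ring

theorem continuous_erfc : Continuous erfc :=
  continuous_iff_continuousAt.2 fun x => (hasDerivAt_erfc x).continuousAt

theorem hasDerivAt_H (x : ℝ) : HasDerivAt H (-erfc x) x := by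
  have hexp : HasDerivAt (fun u : ℝ => Real.exp (-u ^ 2)) (Real.exp (-x ^ 2) * -(2 * x)) x := by
    simpa using ((hasDerivAt_pow 2 x).neg).exp
  refine ((hexp.const_mul (1 / Real.sqrt Real.pi)).sub
    ((hasDerivAt_id x).mul (hasDerivAt_erfc x))).congr_deriv ?_
  simp only [id_eq]
  ring

theorem H_zero : H 0 = 1 / Real.sqrt Real.pi := by
  simp [H]

theorem integral_exp_neg_sub_sq_div {c : ℝ} (hc : 0 < c) (x a b : ℝ) :
    ∫ y in a..b, Real.exp (-(x - y) ^ 2 / c ^ 2) =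
      Real.sqrt Real.pi * c / 2 * (erfc ((x - b) / c) - erfc ((x - a) / c)) := by
  have hpi : Real.sqrt Real.pi ≠ 0 := (Real.sqrt_pos.2 Real.pi_pos).ne'
  rw [mul_sub]
  refine intervalIntegral.integral_eq_sub_of_hasDerivAt
    (f := fun y => Real.sqrt Real.pi * c / 2 * erfc ((x - y) / c)) (fun y _ => ?_)
    (Continuous.intervalIntegrable (by fun_prop) a b)
  refine (((hasDerivAt_erfc ((x - y) / c)).comp y
    (((hasDerivAt_id y).const_sub x).div_const c)).const_mul
    (Real.sqrt Real.pi * c / 2)).congr_deriv ?_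
  rw [div_pow, neg_div]
  field_simp

theorem integral_erfc_sub_div {c : ℝ} (hc : 0 < c) (d a b : ℝ) :
    ∫ x in a..b, erfc ((x - d) / c) = c * (H ((a - d) / c) - H ((b - d) / c)) := by
  have key := intervalIntegral.integral_eq_sub_of_hasDerivAt (a := a) (b := b)
    (f := fun x => -c * H ((x - d) / c)) (f' := fun x => erfc ((x - d) / c)) (fun x _ => ?_)
    (Continuous.intervalIntegrable (continuous_erfc.comp (by fun_prop)) a b)
  · rw [key]
    ring
  · refine (((hasDerivAt_H ((x - d) / c)).comp x
      (((hasDerivAt_id x).sub_const d).div_const c)).const_mul (-c)).congr_deriv ?_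
    field_simp

/-- For all `0 ≤ α ≤ β` and `t > 0`,
`(1/√(4πt)) ∫_α^β ∫₀^α e^{−(x−y)²/(4t)} dy dx
  = √t·(H(β/(2√t)) − H(α/(2√t)) − H((β−α)/(2√t)) + 1/√π)`. -/
theorem boundary_double_integral (α β t : ℝ)
    (hα : 0 ≤ α) (hαβ : α ≤ β) (ht : 0 < t) :
    (1 / Real.sqrt (4 * Real.pi * t))
        * ∫ x in α..β, ∫ y in (0 : ℝ)..α, Real.exp (-(x - y) ^ 2 / (4 * t))
      = Real.sqrt t *
          (H (β / (2 * Real.sqrt t)) - H (α / (2 * Real.sqrt t))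
            - H ((β - α) / (2 * Real.sqrt t)) + 1 / Real.sqrt Real.pi) := by
  obtain ⟨r, hr, rfl⟩ : ∃ r : ℝ, 0 < r ∧ t = r ^ 2 :=
    ⟨Real.sqrt t, Real.sqrt_pos.2 ht, (Real.sq_sqrt ht.le).symm⟩
  have hc : 0 < 2 * r := by positivity
  have hpi : Real.sqrt Real.pi ≠ 0 := (Real.sqrt_pos.2 Real.pi_pos).ne'
  have hpre : Real.sqrt (4 * Real.pi * r ^ 2) = Real.sqrt Real.pi * (2 * r) := by
    rw [show 4 * Real.pi * r ^ 2 = Real.pi * (2 * r) ^ 2 by ring,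
      Real.sqrt_mul Real.pi_pos.le, Real.sqrt_sq hc.le]
  have herfc (d : ℝ) : IntervalIntegrable (fun x => erfc ((x - d) / (2 * r))) volume α β :=
    Continuous.intervalIntegrable (continuous_erfc.comp (by fun_prop)) α β
  rw [Real.sqrt_sq hr.le, hpre, show 4 * r ^ 2 = (2 * r) ^ 2 by ring]
  simp_rw [integral_exp_neg_sub_sq_div hc]
  rw [intervalIntegral.integral_const_mul, intervalIntegral.integral_sub (herfc α) (herfc 0),
    integral_erfc_sub_div hc, integral_erfc_sub_div hc, sub_self, zero_div, H_zero, sub_zero,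
    sub_zero]
  field_simp
  ring
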